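/- arXiv:1005.1951 — 5 statements merged into one kernel-verified Lean document; each statement's English description precedes it below -/
import Mathlib

section
/- Let n ≥ 1, p ∈ [0,1], q = 1 − p, N = n(n−1)/2, and let L ≥ −1 be an integer. Then Σ_G p^{e(G)} q^{N−e(G)} (1/2)^{X(G)} 𝟙[𝓔(G) ≤ L] ≥ (Σ_G p^{e(G)} q^{N−e(G)} (1/2)^{X(G)}) · (Σ_G p^{e(G)} q^{N−e(G)} 𝟙[𝓔(G) ≤ L]), where all sums range over all simple graphs G on the vertex set {1,…,n}. (In probabilistic terms: under the Bernoulli random graph measure, the events of solvability of the random Boolean system and of bounded maximum excess are positively correlated.) -/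
open scoped Classical

/-- Number of edges of a simple graph. -/
noncomputable def edgeCount {V : Type*} (G : SimpleGraph V) : ℕ := G.edgeSet.ncard

/-- Number of connected components of a simple graph. -/
noncomputable def numComponents {V : Type*} (G : SimpleGraph V) : ℕ :=
  Nat.card G.ConnectedComponent

/-- `X(G) = e(G) - v(G) + c(G)`, as an integer. -/
noncomputable def XG {V : Type*} [Fintype V] (G : SimpleGraph V) : ℤ :=
  (edgeCount G : ℤ) - Fintype.card V + numComponents G

/-- The excess `e(H) - v(H)` of the connected component `K` of `G`. -/
noncomputable def compExcess {V : Type*} (G : SimpleGraph V) (K : G.ConnectedComponent) : ℤ :=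
  (({e ∈ G.edgeSet | ∀ v ∈ e, G.connectedComponentMk v = K} : Set (Sym2 V)).ncard : ℤ)
    - ({v : V | G.connectedComponentMk v = K} : Set V).ncard

/-- The maximum excess `𝓔(G)`: the maximum of `e(H) - v(H)` over the connected
components `H` of `G` (for a graph with at least one vertex). -/
noncomputable def maxExcess {V : Type*} (G : SimpleGraph V) : ℤ :=
  sSup (Set.range (compExcess G))

/-- A choice of a root in each connected component gives a spanning forest, presented as a parent
map that decreases a height function at every vertex that is not a root. -/
lemma SimpleGraph.exists_parent_of_roots {V : Type*} (G : SimpleGraph V)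
    (root : G.ConnectedComponent → V) (hroot : ∀ C, G.connectedComponentMk (root C) = C) :
    ∃ (parent : V → V) (height : V → ℕ), ∀ v, v ≠ root (G.connectedComponentMk v) →
      G.Adj v (parent v) ∧ height (parent v) < height v := by
  have key : ∀ v, ∃ u, v ≠ root (G.connectedComponentMk v) →
      G.Adj v u ∧ G.dist u (root (G.connectedComponentMk u)) <
        G.dist v (root (G.connectedComponentMk v)) := by
    intro v
    by_cases hv : v = root (G.connectedComponentMk v)
    · exact ⟨v, fun h => absurd hv h⟩
    · have hr : G.Reachable v (root (G.connectedComponentMk v)) :=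
        SimpleGraph.ConnectedComponent.exact (hroot _).symm
      obtain ⟨w, hw⟩ := hr.exists_walk_length_eq_dist
      generalize hz : root (G.connectedComponentMk v) = z at *
      cases w with
      | nil => exact absurd rfl hv
      | @cons _ u _ huv w =>
        refine ⟨u, fun _ => ⟨huv, ?_⟩⟩
        have hc : G.connectedComponentMk u = G.connectedComponentMk v :=
          SimpleGraph.ConnectedComponent.sound huv.reachable.symm
        rw [hc, hz, ← hw, SimpleGraph.Walk.length_cons]
        exact Nat.lt_succ_of_le (SimpleGraph.dist_le w)
  choose parent hparent using key
  exact ⟨parent, fun v => G.dist v (root (G.connectedComponentMk v)), hparent⟩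

lemma eq_of_sym2_parent_eq {V : Type*} {parent : V → V} {height : V → ℕ} {v w : V}
    (hv : height (parent v) < height v) (hw : height (parent w) < height w)
    (h : s(v, parent v) = s(w, parent w)) : v = w := by
  rcases Sym2.eq_iff.mp h with ⟨h₁, -⟩ | ⟨h₁, h₂⟩
  · exact h₁
  · rw [h₂] at hv
    rw [← h₁] at hw
    omega

lemma exists_compExcess_le_of_le {V : Type*} [Finite V] {G G' : SimpleGraph V} (hle : G ≤ G')
    (K : G.ConnectedComponent) : ∃ K', compExcess G K ≤ compExcess G' K' := by
  induction K using SimpleGraph.ConnectedComponent.ind with | _ k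
  obtain ⟨parent, height, hp⟩ := G'.exists_parent_of_roots
    (fun C => if C = G'.connectedComponentMk k then k else C.out) (by
      intro C
      split_ifs with h
      · exact h.symm
      · exact Quot.out_eq C)
  have hcomp : ∀ {v w}, G.connectedComponentMk v = G.connectedComponentMk w →
      G'.connectedComponentMk v = G'.connectedComponentMk w := fun h =>
    SimpleGraph.ConnectedComponent.sound ((SimpleGraph.ConnectedComponent.exact h).mono hle)
  refine ⟨G'.connectedComponentMk k, ?_⟩
  unfold compExcess
  set S : Set (Sym2 V) := {e ∈ G.edgeSet | ∀ v ∈ e, G.connectedComponentMk v =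
    G.connectedComponentMk k}
  set S' : Set (Sym2 V) := {e ∈ G'.edgeSet | ∀ v ∈ e, G'.connectedComponentMk v =
    G'.connectedComponentMk k}
  set T : Set V := {v | G.connectedComponentMk v = G.connectedComponentMk k}
  set T' : Set V := {v | G'.connectedComponentMk v = G'.connectedComponentMk k}
  have hS : S ⊆ S' := fun e he =>
    ⟨SimpleGraph.edgeSet_mono hle he.1, fun v hv => hcomp (he.2 v hv)⟩
  have hT : T ⊆ T' := fun v hv => hcomp hv
  have hpar : ∀ v ∈ T' \ T, G'.Adj v (parent v) ∧ height (parent v) < height v := by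
    rintro v ⟨hv', hv⟩
    refine hp v fun h => hv ?_
    have hvk : v = k := h.trans (if_pos hv')
    exact congrArg _ hvk
  have hcard : (T' \ T).ncard ≤ (S' \ S).ncard := by
    refine Set.ncard_le_ncard_of_injOn (fun v => s(v, parent v)) ?_ ?_
    · intro v hv
      have hadj := (hpar v hv).1
      refine ⟨⟨hadj, ?_⟩, fun h => hv.2 (h.2 v (Sym2.mem_mk_left _ _))⟩
      intro w hw
      rcases Sym2.mem_iff.mp hw with rfl | rfl
      · exact hv.1
      · exact (SimpleGraph.ConnectedComponent.sound hadj.reachable.symm).trans hv.1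
    · intro v hv w hw h
      exact eq_of_sym2_parent_eq (hpar v hv).2 (hpar w hw).2 h
  have h₁ := Set.ncard_sdiff_add_ncard_of_subset hS
  have h₂ := Set.ncard_sdiff_add_ncard_of_subset hT
  omega

lemma maxExcess_mono {V : Type*} [Finite V] [Nonempty V] :
    Monotone (maxExcess : SimpleGraph V → ℤ) := by
  intro G G' hle
  refine csSup_le (Set.range_nonempty _) ?_
  rintro _ ⟨K, rfl⟩
  obtain ⟨K', hK'⟩ := exists_compExcess_le_of_le hle K
  exact hK'.trans (le_csSup (Set.finite_range _).bddAbove ⟨K', rfl⟩)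

lemma XG_mono {V : Type*} [Fintype V] : Monotone (XG : SimpleGraph V → ℤ) := by
  intro G G' hle
  set root : G'.ConnectedComponent → V := fun C => C.out
  obtain ⟨parent, height, hp⟩ := G'.exists_parent_of_roots root (fun C => Quot.out_eq C)
  set R : Set G.ConnectedComponent := Set.range fun C => G.connectedComponentMk (root C)
  have hR : R.ncard ≤ numComponents G' := by
    rw [numComponents, ← Set.ncard_univ, show R = _ from Set.image_univ.symm]
    exact Set.ncard_image_le
  have key : ∀ K : G.ConnectedComponent, ∃ v, K ∈ Rᶜ → G.connectedComponentMk v = K ∧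
      G'.Adj v (parent v) ∧ height (parent v) < height v ∧ ¬ G.Adj v (parent v) := by
    intro K
    by_cases hK : K ∈ R
    · exact ⟨K.out, fun h => absurd hK h⟩
    · obtain ⟨v, hv, hmin⟩ := (measure height).wf.has_min {v | G.connectedComponentMk v = K}
        ⟨K.out, Quot.out_eq K⟩
      have hv_ne : v ≠ root (G'.connectedComponentMk v) := by
        intro h
        exact hK ⟨G'.connectedComponentMk v, (congrArg _ h.symm).trans hv⟩
      obtain ⟨hadj, hlt⟩ := hp v hv_ne
      refine ⟨v, fun _ => ⟨hv, hadj, hlt, fun h => hmin (parent v) ?_ hlt⟩⟩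
      exact (SimpleGraph.ConnectedComponent.sound h.reachable.symm).trans hv
  choose f hf using key
  have hcard : Rᶜ.ncard ≤ (G'.edgeSet \ G.edgeSet).ncard := by
    refine Set.ncard_le_ncard_of_injOn (fun K => s(f K, parent (f K))) ?_ ?_
    · intro K hK
      exact ⟨(hf K hK).2.1, (hf K hK).2.2.2⟩
    · intro K hK K' hK' h
      rw [← (hf K hK).1, ← (hf K' hK').1,
        eq_of_sym2_parent_eq (hf K hK).2.2.1 (hf K' hK').2.2.1 h]
  have h₁ := Set.ncard_sdiff_add_ncard_of_subset (SimpleGraph.edgeSet_mono hle)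
  have h₂ := Set.ncard_add_ncard_compl R
  simp only [XG, edgeCount]
  rw [← numComponents] at h₂
  omega

lemma edgeCount_inf_add_edgeCount_sup {V : Type*} [Finite V] (G G' : SimpleGraph V) :
    edgeCount (G ⊓ G') + edgeCount (G ⊔ G') = edgeCount G + edgeCount G' := by
  simp only [edgeCount, SimpleGraph.edgeSet_inf, SimpleGraph.edgeSet_sup]
  rw [add_comm, Set.ncard_union_add_ncard_inter]

lemma edgeCount_eq_card_edgeFinset {V : Type*} [Fintype V] (G : SimpleGraph V) :
    edgeCount G = G.edgeFinset.card := by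
  rw [edgeCount, ← SimpleGraph.coe_edgeFinset, Set.ncard_coe_finset]

lemma edgeCount_le_choose_two {V : Type*} [Fintype V] (G : SimpleGraph V) :
    edgeCount G ≤ (Fintype.card V).choose 2 := by
  rw [edgeCount_eq_card_edgeFinset]
  exact G.card_edgeFinset_le_card_choose_two

lemma sum_pow_edgeCount_mul_pow {V R : Type*} [Fintype V] [DecidableEq V] [CommSemiring R] (p q : R) :
    ∑ G : SimpleGraph V, p ^ edgeCount G * q ^ ((Fintype.card V).choose 2 - edgeCount G) =
      (p + q) ^ (Fintype.card V).choose 2 := by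
  rw [← SimpleGraph.card_edgeFinset_top_eq_card_choose_two (V := V),
    ← Finset.sum_pow_mul_eq_add_pow]
  refine Finset.sum_bij (fun G _ => G.edgeFinset) ?_ ?_ ?_ ?_
  · intro G _
    exact Finset.mem_powerset.mpr (SimpleGraph.edgeFinset_mono le_top)
  · intro G _ G' _ h
    exact SimpleGraph.edgeFinset_inj.mp h
  · intro s hs
    refine ⟨SimpleGraph.fromEdgeSet s, Finset.mem_univ _, ?_⟩
    rw [← Finset.coe_inj, SimpleGraph.coe_edgeFinset, SimpleGraph.edgeSet_fromEdgeSet,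
      sdiff_eq_left, Set.disjoint_left]
    intro e he hd
    have := Finset.mem_powerset.mp hs he
    rw [SimpleGraph.mem_edgeFinset] at this
    exact SimpleGraph.not_isDiag_of_mem_edgeSet _ this hd
  · intro G _
    rw [edgeCount_eq_card_edgeFinset]

/-- Harris's inequality for decreasing functions of a Bernoulli random graph. -/
lemma sum_mul_sum_le_sum_mul_of_antitone {V : Type*} [Fintype V] [DecidableEq V] {p q : ℝ} (hp : 0 ≤ p)
    (hq : 0 ≤ q) (hpq : p + q = 1) {f g : SimpleGraph V → ℝ} (hf₀ : 0 ≤ f) (hg₀ : 0 ≤ g)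
    (hf : Antitone f) (hg : Antitone g) :
    (∑ G, p ^ edgeCount G * q ^ ((Fintype.card V).choose 2 - edgeCount G) * f G) *
        (∑ G, p ^ edgeCount G * q ^ ((Fintype.card V).choose 2 - edgeCount G) * g G) ≤
      ∑ G, p ^ edgeCount G * q ^ ((Fintype.card V).choose 2 - edgeCount G) * (f G * g G) := by
  set μ : SimpleGraph V → ℝ :=
    fun G => p ^ edgeCount G * q ^ ((Fintype.card V).choose 2 - edgeCount G)
  have hμ : ∀ a b, μ a * μ b ≤ μ (a ⊔ b) * μ (a ⊓ b) := by
    intro a b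
    have h := edgeCount_inf_add_edgeCount_sup a b
    have h₁ := edgeCount_le_choose_two a
    have h₂ := edgeCount_le_choose_two b
    have h₃ := edgeCount_le_choose_two (a ⊔ b)
    have h₄ := edgeCount_le_choose_two (a ⊓ b)
    simp only [μ]
    rw [mul_mul_mul_comm, ← pow_add, ← pow_add, mul_mul_mul_comm, ← pow_add, ← pow_add]
    apply le_of_eq
    congr 2 <;> omega
  have h := fkg (α := (SimpleGraph V)ᵒᵈ) (μ := μ ∘ OrderDual.ofDual) (f := f ∘ OrderDual.ofDual)
    (g := g ∘ OrderDual.ofDual) (fun G => by dsimp [μ]; positivity) (fun G => hf₀ _)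
    (fun G => hg₀ _) hf.dual_left hg.dual_left hμ
  have h₁ : ∑ G, μ G = 1 := by rw [sum_pow_edgeCount_mul_pow, hpq, one_pow]
  calc _ ≤ (∑ G, μ G) * ∑ G, μ G * (f G * g G) := h
    _ = _ := by rw [h₁, one_mul]

/-- positive correlation (FKG) of solvability and bounded maximum excess
under the Bernoulli random graph measure: with `N = n(n-1)/2`,
`Σ_G p^{e} q^{N-e} (1/2)^{X(G)} 𝟙[𝓔(G) ≤ L]
  ≥ (Σ_G p^{e} q^{N-e} (1/2)^{X(G)}) · (Σ_G p^{e} q^{N-e} 𝟙[𝓔(G) ≤ L])`. -/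
theorem solvable_and_excess_positively_correlated
    (n : ℕ) (hn : 1 ≤ n) (p : ℝ) (hp0 : 0 ≤ p) (hp1 : p ≤ 1) (q : ℝ) (hq : q = 1 - p)
    (L : ℤ) (hL : -1 ≤ L) :
    (∑ G : SimpleGraph (Fin n),
        p ^ edgeCount G * q ^ (n * (n - 1) / 2 - edgeCount G) * (1 / 2 : ℝ) ^ XG G *
          (if maxExcess G ≤ L then 1 else 0))
      ≥ (∑ G : SimpleGraph (Fin n),
          p ^ edgeCount G * q ^ (n * (n - 1) / 2 - edgeCount G) * (1 / 2 : ℝ) ^ XG G) *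
        (∑ G : SimpleGraph (Fin n),
          p ^ edgeCount G * q ^ (n * (n - 1) / 2 - edgeCount G) *
            (if maxExcess G ≤ L then 1 else 0)) := by
  have : Nonempty (Fin n) := ⟨⟨0, hn⟩⟩
  have h := sum_mul_sum_le_sum_mul_of_antitone (V := Fin n) hp0 (q := q) (by linarith)
    (by linarith) (f := fun G => (1 / 2 : ℝ) ^ XG G)
    (g := fun G => if maxExcess G ≤ L then 1 else 0) (fun G => by dsimp; positivity)
    (fun G => by dsimp; positivity)
    (fun G G' hle => zpow_le_zpow_right_of_le_one₀ (by norm_num) (by norm_num) (XG_mono hle))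
    (fun G G' hle => by
      have := maxExcess_mono hle
      dsimp only
      split_ifs
      · exact le_rfl
      · omega
      · exact zero_le_one
      · exact le_rfl)
  simpa only [Fintype.card_fin, Nat.choose_two_right, mul_assoc, ge_iff_le] using h
end

section
/- For all natural numbers r and j with j ≤ r, one has binom(r,j) · binom(2r,2j) · binom(3r,3j) ≤ binom(6r,6j). -/
/-- A single term of Vandermonde's convolution is at most the whole sum. -/
theorem choose_mul_choose_le_add_choose (m n i k : ℕ) :
    m.choose i * n.choose k ≤ (m + n).choose (i + k) := by
  rw [Nat.add_choose_eq]
  exact Finset.single_le_sum (f := fun ij : ℕ × ℕ => m.choose ij.1 * n.choose ij.2)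
    (fun _ _ => Nat.zero_le _) (Finset.HasAntidiagonal.mem_antidiagonal.mpr (rfl : (i, k).1 + (i, k).2 = i + k))

/-- for natural numbers `j ≤ r`,
`binom(r,j) · binom(2r,2j) · binom(3r,3j) ≤ binom(6r,6j)`. -/
theorem choose_product_le (r j : ℕ) (h : j ≤ r) :
    r.choose j * (2 * r).choose (2 * j) * (3 * r).choose (3 * j) ≤ (6 * r).choose (6 * j) := by
  calc
    _ ≤ (r + 2 * r).choose (j + 2 * j) * (3 * r).choose (3 * j) :=
      Nat.mul_le_mul_right _ (choose_mul_choose_le_add_choose _ _ _ _)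
    _ ≤ (r + 2 * r + 3 * r).choose (j + 2 * j + 3 * j) := choose_mul_choose_le_add_choose _ _ _ _
    _ = (6 * r).choose (6 * j) := by ring_nf
end

section
/- Let ε_r := (6r)!/(2^{5r}·3^{2r}·(3r)!·(2r)!) and let (f_r)_{r≥0} be defined by f_0 = 1 and Σ_{k=0}^{r} f_k f_{r−k} = ε_r for r ≥ 1. Then for every r ≥ 1, (ε_r/2)·(1 − 1/r) ≤ f_r ≤ ε_r/2. -/
/-- `ε_r = (6r)! / (2^{5r} 3^{2r} (3r)! (2r)!)`. -/
noncomputable def epsr (r : ℕ) : ℝ :=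
  ((6 * r).factorial : ℝ) /
    (2 ^ (5 * r) * 3 ^ (2 * r) * ((3 * r).factorial : ℝ) * ((2 * r).factorial : ℝ))

theorem epsr_pos (r : ℕ) : 0 < epsr r := by
  unfold epsr
  positivity

theorem epsr_succ (r : ℕ) :
    epsr (r + 1) = (6 * r + 1) * (6 * r + 5) / (24 * (r + 1)) * epsr r := by
  unfold epsr
  rw [show 6 * (r + 1) = 6 * r + 5 + 1 by ring, show 3 * (r + 1) = 3 * r + 2 + 1 by ring,
    show 2 * (r + 1) = 2 * r + 1 + 1 by ring, show 5 * (r + 1) = 5 * r + 5 by ring]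
  simp only [Nat.factorial_succ, pow_add]
  push_cast
  field_simp
  ring

theorem epsr_one : epsr 1 = 5 / 24 := by
  norm_num [epsr, Nat.factorial]

theorem epsr_succ_le {r : ℕ} (hr : 1 ≤ r) : epsr (r + 1) ≤ (3 / 2 * r + 5 / 48) * epsr r := by
  rw [epsr_succ]
  refine mul_le_mul_of_nonneg_right ?_ (epsr_pos r).le
  have hr' : (1 : ℝ) ≤ r := by exact_mod_cast hr
  rw [div_le_iff₀ (by positivity)]
  nlinarith

theorem le_epsr_succ (r : ℕ) : 3 / 2 * r * epsr r ≤ epsr (r + 1) := by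
  rw [epsr_succ]
  refine mul_le_mul_of_nonneg_right ?_ (epsr_pos r).le
  rw [le_div_iff₀ (by positivity)]
  nlinarith

/-- The convolution `Σ_{j=1}^{n} ε_j ε_{n+1-j}`. -/
noncomputable def epsrConv (n : ℕ) : ℝ :=
  ∑ k ∈ Finset.range n, epsr (k + 1) * epsr (n - k)

theorem epsrConv_succ_le (n : ℕ) :
    epsrConv (n + 1) ≤
      (3 / 4 * (n + 1) + 5 / 48) * epsrConv n + 5 / 24 * epsr (n + 1) := by
  have h₁ : epsrConv (n + 1) =
      ∑ k ∈ Finset.range n, epsr (k + 1) * epsr (n - k + 1) + 5 / 24 * epsr (n + 1) := by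
    rw [epsrConv, Finset.sum_range_succ, Nat.add_sub_cancel_left, epsr_one,
      mul_comm (epsr (n + 1))]
    congr 1
    refine Finset.sum_congr rfl fun k hk => ?_
    rw [Nat.sub_add_comm (Finset.mem_range.1 hk).le]
  have h₂ : epsrConv (n + 1) =
      ∑ k ∈ Finset.range n, epsr (k + 1 + 1) * epsr (n - k) + 5 / 24 * epsr (n + 1) := by
    rw [epsrConv, Finset.sum_range_succ', Nat.sub_zero, zero_add, epsr_one]
    simp only [Nat.add_sub_add_right]
  have h : ∑ k ∈ Finset.range n, epsr (k + 1) * epsr (n - k + 1) +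
      ∑ k ∈ Finset.range n, epsr (k + 1 + 1) * epsr (n - k) ≤
        2 * (3 / 4 * (n + 1) + 5 / 48) * epsrConv n := by
    rw [epsrConv, ← Finset.sum_add_distrib, Finset.mul_sum]
    refine Finset.sum_le_sum fun k hk => ?_
    have hk : k < n := Finset.mem_range.1 hk
    have ha := mul_le_mul_of_nonneg_left (epsr_succ_le (show 1 ≤ n - k by omega))
      (epsr_pos (k + 1)).le
    have hb := mul_le_mul_of_nonneg_right (epsr_succ_le (show 1 ≤ k + 1 by omega))
      (epsr_pos (n - k)).le
    rw [Nat.cast_sub hk.le] at ha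
    push_cast at hb
    linarith
  linarith

theorem epsrConv_step_bound {x E : ℝ} (hx : 0 ≤ x) (hE : 0 ≤ E) :
    (x + 3) * ((3 / 4 * (x + 1 + 1) + 5 / 48) * (4 * E / (x + 2)) + 5 / 24 * E) ≤
      4 * (3 / 2 * (x + 1 + 1) * E) := by
  have h : 4 * (3 / 2 * (x + 1 + 1) * E) -
      (x + 3) * ((3 / 4 * (x + 1 + 1) + 5 / 48) * (4 * E / (x + 2)) + 5 / 24 * E) =
      E * (67 * x ^ 2 + 181 * x + 84) / (24 * (x + 2)) := by
    field_simp
    ring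
  rw [← sub_nonneg, h]
  positivity

theorem epsrConv_le (n : ℕ) : (n + 1) * epsrConv n ≤ 4 * epsr (n + 1) := by
  induction n with
  | zero => simpa [epsrConv] using (epsr_pos 1).le
  | succ n ih =>
    rcases n with _ | n
    · norm_num [epsrConv, epsr_succ 1, epsr_one]
    · have h := epsrConv_succ_le (n + 1)
      have hl := le_epsr_succ (n + 1 + 1)
      have hE := epsr_pos (n + 1 + 1)
      push_cast at h hl ih ⊢
      generalize epsr (n + 1 + 1) = E at *
      have hn : (0 : ℝ) ≤ n := n.cast_nonneg
      have hC : epsrConv (n + 1) ≤ 4 * E / (n + 2) := by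
        rw [le_div_iff₀ (by positivity)]
        linarith
      have hC' := mul_le_mul_of_nonneg_left hC
        (show (0 : ℝ) ≤ 3 / 4 * (n + 1 + 1) + 5 / 48 by positivity)
      have := mul_le_mul_of_nonneg_left (h.trans (add_le_add hC' le_rfl))
        (show (0 : ℝ) ≤ n + 3 by positivity)
      linarith [epsrConv_step_bound hn hE.le]

/-- if `f 0 = 1` and `Σ_{k=0}^r f k · f (r-k) = ε_r` for all `r ≥ 1`, then
for every `r ≥ 1`, `(ε_r/2)(1 - 1/r) ≤ f r ≤ ε_r/2`. -/
theorem f_bounds (f : ℕ → ℝ) (hf0 : f 0 = 1)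
    (hrec : ∀ r : ℕ, 1 ≤ r → ∑ k ∈ Finset.range (r + 1), f k * f (r - k) = epsr r) :
    ∀ r : ℕ, 1 ≤ r → epsr r / 2 * (1 - 1 / (r : ℝ)) ≤ f r ∧ f r ≤ epsr r / 2 := by
  intro r
  induction r using Nat.strong_induction_on with
  | _ r ih =>
  intro hr
  obtain ⟨n, rfl⟩ := Nat.exists_eq_add_of_le' hr
  have hrec' := hrec (n + 1) hr
  rw [Finset.sum_range_succ, Finset.sum_range_succ'] at hrec'
  simp only [Nat.add_sub_add_right, Nat.sub_self, Nat.sub_zero, hf0] at hrec'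
  have hf : ∀ k, 1 ≤ k → k < n + 1 → 0 ≤ f k ∧ f k ≤ epsr k / 2 := by
    intro k hk hkn
    obtain ⟨hlow, hup⟩ := ih k hkn hk
    refine ⟨le_trans (mul_nonneg (half_pos (epsr_pos k)).le ?_) hlow, hup⟩
    have hk' : (1 : ℝ) ≤ k := by exact_mod_cast hk
    rw [sub_nonneg]
    exact div_le_one_of_le₀ hk' (by positivity)
  have hnonneg : 0 ≤ ∑ k ∈ Finset.range n, f (k + 1) * f (n - k) := by
    refine Finset.sum_nonneg fun k hk => ?_
    have hk : k < n := Finset.mem_range.1 hk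
    exact mul_nonneg (hf _ (by omega) (by omega)).1 (hf _ (by omega) (by omega)).1
  have hle : ∑ k ∈ Finset.range n, f (k + 1) * f (n - k) ≤ 1 / 4 * epsrConv n := by
    rw [epsrConv, Finset.mul_sum]
    refine Finset.sum_le_sum fun k hk => ?_
    have hk : k < n := Finset.mem_range.1 hk
    obtain ⟨-, h₁⟩ := hf (k + 1) (by omega) (by omega)
    obtain ⟨h₀, h₂⟩ := hf (n - k) (by omega) (by omega)
    have := mul_le_mul h₁ h₂ h₀ (half_pos (epsr_pos _)).le
    linarith
  have hconv : epsrConv n ≤ 4 * (epsr (n + 1) * (1 / ((n + 1 : ℕ) : ℝ))) := by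
    rw [mul_one_div, ← mul_div_assoc, le_div_iff₀ (by positivity)]
    push_cast
    linarith [epsrConv_le n]
  constructor <;> linarith
end

section
/- For all natural numbers n ≥ 1 and m ≥ 0, one has 2^{m+1} · C^e(n,m) ≤ 2^n · C(n,m); that is, the number of connected simple graphs on {1,…,n} with m edges and no odd cycle is at most (1/2)^{m+1−n} times the number of all connected simple graphs on {1,…,n} with m edges. -/
/-- `G` has no odd cycle. -/
def HasNoOddCycle {V : Type*} (G : SimpleGraph V) : Prop :=
  ∀ (v : V) (w : G.Walk v v), w.IsCycle → Even w.length

/-- `C(k,m)`: the number of connected simple graphs on `{1,…,k}` with exactly `m` edges. -/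
noncomputable def Cconn (k m : ℕ) : ℕ :=
  Nat.card {G : SimpleGraph (Fin k) // G.Connected ∧ edgeCount G = m}

/-- `C^e(k,m)`: the number of connected simple graphs on `{1,…,k}` with exactly `m`
edges and no odd cycle. -/
noncomputable def CconnE (k m : ℕ) : ℕ :=
  Nat.card {G : SimpleGraph (Fin k) // G.Connected ∧ edgeCount G = m ∧ HasNoOddCycle G}

open Finset Polynomial

section CoefficientwiseOrder

/-- The coefficientwise order on polynomials with natural number coefficients. -/
def CoeffLE (p q : ℕ[X]) : Prop := ∀ i, p.coeff i ≤ q.coeff i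

namespace CoeffLE

variable {p q r s : ℕ[X]}

theorem rfl : CoeffLE p p := fun _ => le_rfl

theorem trans (h₁ : CoeffLE p q) (h₂ : CoeffLE q r) : CoeffLE p r :=
  fun i => (h₁ i).trans (h₂ i)

theorem of_eq (h : p = q) : CoeffLE p q := h ▸ rfl

theorem zero_le : CoeffLE 0 p := fun i => by simp

theorem add (h₁ : CoeffLE p q) (h₂ : CoeffLE r s) : CoeffLE (p + r) (q + s) := fun i => by
  simpa using Nat.add_le_add (h₁ i) (h₂ i)

theorem mul (h₁ : CoeffLE p q) (h₂ : CoeffLE r s) : CoeffLE (p * r) (q * s) := fun i => by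
  rw [coeff_mul, coeff_mul]
  exact sum_le_sum fun x _ => Nat.mul_le_mul (h₁ _) (h₂ _)

theorem sum {ι : Type*} {t : Finset ι} {f g : ι → ℕ[X]} (h : ∀ i ∈ t, CoeffLE (f i) (g i)) :
    CoeffLE (∑ i ∈ t, f i) (∑ i ∈ t, g i) := fun n => by
  rw [finsetSum_coeff, finsetSum_coeff]
  exact sum_le_sum fun i hi => h i hi n

theorem sum_le_of_subset {ι : Type*} {t u : Finset ι} {f : ι → ℕ[X]} (h : t ⊆ u) :
    CoeffLE (∑ i ∈ t, f i) (∑ i ∈ u, f i) := fun n => by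
  rw [finsetSum_coeff, finsetSum_coeff]
  exact sum_le_sum_of_subset h

theorem pow (h : CoeffLE p q) (n : ℕ) : CoeffLE (p ^ n) (q ^ n) := by
  induction n with
  | zero => simpa using rfl
  | succ n ih => simpa only [pow_succ] using ih.mul h

theorem one_le_one_add_X_pow (n : ℕ) : CoeffLE 1 ((1 + X) ^ n) := by
  have h : CoeffLE 1 (1 + X) := by simpa using (rfl (p := 1)).add (zero_le (p := X))
  simpa using h.pow n

theorem one_add_X_pow_le {m n : ℕ} (h : m ≤ n) : CoeffLE ((1 + X) ^ m) ((1 + X) ^ n) := by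
  obtain ⟨k, hk⟩ := Nat.exists_eq_add_of_le h
  subst hk
  rw [pow_add]
  simpa using (rfl (p := (1 + X) ^ m)).mul (one_le_one_add_X_pow k)

theorem one_add_two_X_pow_le (n : ℕ) : CoeffLE ((1 + C 2 * X) ^ n) ((1 + X) ^ (2 * n)) := by
  rw [pow_mul]
  refine pow ?_ n
  have h : ((1 + X) ^ 2 : ℕ[X]) = (1 + C 2 * X) + X ^ 2 := by
    simp only [map_ofNat]; ring
  rw [h]
  simpa only [add_zero] using (rfl (p := 1 + C 2 * X)).add (zero_le (p := X ^ 2))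

end CoeffLE

end CoefficientwiseOrder

theorem sum_powerset_pow_card {V : Type*} (c : ℕ) (R : Finset V) :
    ∑ E ∈ R.powerset, (C c * X : ℕ[X]) ^ #E = (1 + C c * X) ^ #R := by
  simpa [add_comm] using sum_pow_mul_eq_add_pow (C c * X : ℕ[X]) 1 R

namespace SimpleGraph

theorem even_length_add_length_bypass {V : Type*} [DecidableEq V] {G : SimpleGraph V}
    (hG : HasNoOddCycle G) {u v : V} (w : G.Walk u v) : Even (w.length + w.bypass.length) := by
  induction w with
  | nil => simp [Walk.bypass]
  | @cons u v x h p ih =>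
    simp only [Walk.bypass]
    split_ifs with hs
    · have hlen := congrArg Walk.length (p.bypass.take_spec hs)
      rw [Walk.length_append] at hlen
      have hpath : (p.bypass.takeUntil u hs).IsPath := p.bypass_isPath.takeUntil hs
      have heven : Even ((p.bypass.takeUntil u hs).length + 1) := by
        by_cases he : s(u, v) ∈ (p.bypass.takeUntil u hs).edges
        · rw [Sym2.eq_swap] at he
          rw [hpath.length_eq_one_of_mem_edges he]
          decide
        · simpa using hG u _ ((Walk.cons_isCycle_iff _ h).2 ⟨hpath, he⟩)
      rw [Walk.length_cons]
      rw [Nat.even_iff] at *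
      omega
    · rw [Walk.length_cons, Walk.length_cons]
      rw [Nat.even_iff] at *
      omega

theorem colorable_two_of_hasNoOddCycle {V : Type*} {G : SimpleGraph V} (hG : HasNoOddCycle G) :
    G.Colorable 2 := by
  classical
  rw [two_colorable_iff_forall_loop_even]
  intro u w
  have h := even_length_add_length_bypass hG w
  rwa [(Walk.isPath_iff_nil.1 w.bypass_isPath).length_eq_zero, add_zero] at h

/-- `H` has a proper 2-coloring in which `P` and `Q` are monochromatic of different colors. -/
def Separable {V : Type*} (P Q : Finset V) (H : SimpleGraph V) : Prop :=
  ∃ c : V → Bool, (∀ a ∈ P, c a = true) ∧ (∀ a ∈ Q, c a = false) ∧ ∀ a b, H.Adj a b → c a ≠ c b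

theorem Separable.symm {V : Type*} {P Q : Finset V} {H : SimpleGraph V} (h : Separable P Q H) :
    Separable Q P H := by
  obtain ⟨c, hP, hQ, hc⟩ := h
  exact ⟨fun a => !c a, fun a ha => by simp [hQ a ha], fun a ha => by simp [hP a ha],
    fun a b hab => by simpa using hc a b hab⟩

theorem separable_of_hasNoOddCycle {V : Type*} {H : SimpleGraph V} (h : HasNoOddCycle H) (r : V) :
    Separable {r} ∅ H := by
  obtain ⟨c⟩ := colorable_two_of_hasNoOddCycle h
  refine ⟨fun a => decide (c a = c r), by simp, by simp, fun a b hab heq => ?_⟩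
  have hne := c.valid hab
  have : c a = c r ↔ c b = c r := by simpa using heq
  omega

variable {V : Type*} [DecidableEq V]

/-- The graph `H` with all edges from `v` to the other vertices of `N` added. -/
def addStar (H : SimpleGraph V) (v : V) (N : Finset V) : SimpleGraph V where
  Adj a b := H.Adj a b ∨ (a = v ∧ b ∈ N.erase v) ∨ (b = v ∧ a ∈ N.erase v)
  symm := ⟨fun a b h => by
    rcases h with h | h | h
    · exact Or.inl h.symm
    · exact Or.inr (Or.inr h)
    · exact Or.inr (Or.inl h)⟩
  loopless := ⟨fun a h => by
    rcases h with h | ⟨rfl, h⟩ | ⟨rfl, h⟩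
    · exact H.loopless.irrefl a h
    · simp at h
    · simp at h⟩

theorem addStar_adj {H : SimpleGraph V} {v : V} {N : Finset V} (hv : v ∉ N) {a b : V} :
    (H.addStar v N).Adj a b ↔ H.Adj a b ∨ (a = v ∧ b ∈ N) ∨ (b = v ∧ a ∈ N) := by
  simp only [addStar, erase_eq_of_notMem hv]

theorem edgeCount_addStar [Finite V] {H : SimpleGraph V} {v : V} {N : Finset V} (hv : v ∉ N)
    (hH : v ∉ H.support) : edgeCount (H.addStar v N) = #N + edgeCount H := by
  have hE : (H.addStar v N).edgeSet = (fun b => s(v, b)) '' (N : Set V) ∪ H.edgeSet := by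
    ext e
    induction e with
    | _ a b =>
      simp only [mem_edgeSet, addStar_adj hv, Set.mem_union, Set.mem_image, mem_coe, Sym2.eq_iff]
      constructor
      · rintro (h | ⟨rfl, h⟩ | ⟨rfl, h⟩)
        · exact Or.inr h
        · exact Or.inl ⟨b, h, Or.inl ⟨rfl, rfl⟩⟩
        · exact Or.inl ⟨a, h, Or.inr ⟨rfl, rfl⟩⟩
      · rintro (⟨x, hx, ⟨rfl, rfl⟩ | ⟨rfl, rfl⟩⟩ | h)
        · exact Or.inr (Or.inl ⟨rfl, hx⟩)
        · exact Or.inr (Or.inr ⟨rfl, hx⟩)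
        · exact Or.inl h
  have hdisj : Disjoint ((fun b => s(v, b)) '' (N : Set V)) H.edgeSet := by
    rw [Set.disjoint_left]
    rintro _ ⟨b, -, rfl⟩ h
    exact hH ⟨b, h⟩
  rw [edgeCount, hE, Set.ncard_union_eq hdisj (Set.toFinite _) (Set.toFinite _),
    Set.ncard_image_of_injective _ fun a b h => Sym2.congr_right.1 h, Set.ncard_coe_finset, edgeCount]

/-- Every nonempty set of vertices in `U` has an edge leaving it; for finite graphs this says that
every vertex of `U` is connected to a vertex outside `U`. -/
def Linked (U : Finset V) (H : SimpleGraph V) : Prop :=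
  ∀ S ⊆ U, S.Nonempty → ∃ s ∈ S, ∃ t ∉ S, H.Adj s t

theorem linked_addStar {H : SimpleGraph V} {v : V} {U D E : Finset V} (hD : D ⊆ U)
    (hE : Disjoint E U) (hvE : v ∉ E) (hvU : v ∉ U) :
    Linked U (H.addStar v (D ∪ E)) ↔ Linked (U \ D) H := by
  have hv : v ∉ D ∪ E := by
    simp only [mem_union, not_or]
    exact ⟨fun h => hvU (hD h), hvE⟩
  constructor
  · intro h S hS hne
    obtain ⟨s, hs, t, ht, hadj⟩ := h S (hS.trans sdiff_subset) hne
    refine ⟨s, hs, t, ht, ?_⟩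
    have hsU := mem_sdiff.1 (hS hs)
    rw [addStar_adj hv] at hadj
    rcases hadj with hadj | ⟨rfl, -⟩ | ⟨-, hsN⟩
    · exact hadj
    · exact absurd hsU.1 hvU
    · rcases mem_union.1 hsN with h | h
      · exact absurd h hsU.2
      · exact absurd hsU.1 (Finset.disjoint_left.1 hE h)
  · intro h S hS hne
    by_cases hSD : ∃ s ∈ S, s ∈ D
    · obtain ⟨s, hs, hsD⟩ := hSD
      exact ⟨s, hs, v, fun hvS => hvU (hS hvS),
        (addStar_adj hv).2 (Or.inr (Or.inr ⟨rfl, mem_union_left _ hsD⟩))⟩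
    · push Not at hSD
      obtain ⟨s, hs, t, ht, hadj⟩ := h S (fun s hs => mem_sdiff.2 ⟨hS hs, hSD s hs⟩) hne
      exact ⟨s, hs, t, ht, (addStar_adj hv).2 (Or.inl hadj)⟩

theorem Separable.of_addStar {H : SimpleGraph V} {v : V} {P Q D E : Finset V} (hv : v ∈ P)
    (hvN : v ∉ D ∪ E) (h : Separable P Q (H.addStar v (D ∪ E))) :
    Separable (P.erase v) (Q ∪ D) H ∧ Disjoint E P := by
  obtain ⟨c, hP, hQ, hc⟩ := h
  have hN : ∀ a ∈ D ∪ E, c a = false := fun a ha => by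
    have := hc v a ((addStar_adj hvN).2 (Or.inr (Or.inl ⟨_root_.rfl, ha⟩)))
    rw [hP v hv] at this
    simpa using this.symm
  refine ⟨⟨c, fun a ha => hP a (mem_of_mem_erase ha), fun a ha => ?_, fun a b hab =>
    hc a b ((addStar_adj hvN).2 (Or.inl hab))⟩, Finset.disjoint_left.2 fun a ha haP => ?_⟩
  · rcases mem_union.1 ha with h | h
    · exact hQ a h
    · exact hN a (mem_union_left _ h)
  · simpa [hP a haP] using hN a (mem_union_right _ ha)

variable [Fintype V]

open Classical in
/-- The graphs with all edges inside `W` that satisfy `p`. -/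
noncomputable def graphsOn (W : Finset V) (p : SimpleGraph V → Prop) : Finset (SimpleGraph V) :=
  univ.filter fun H => H.support ⊆ W ∧ p H

/-- The generating function by number of edges, evaluated at `c * X`, of the graphs with all edges
inside `W` that satisfy `p`. -/
noncomputable def edgeGenFun (c : ℕ) (W : Finset V) (p : SimpleGraph V → Prop) : ℕ[X] :=
  ∑ H ∈ graphsOn W p, (C c * X) ^ edgeCount H

theorem mem_graphsOn {W : Finset V} {p : SimpleGraph V → Prop} {H : SimpleGraph V} :
    H ∈ graphsOn W p ↔ H.support ⊆ W ∧ p H := by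
  simp [graphsOn]

theorem edgeGenFun_mono {c : ℕ} {W : Finset V} {p q : SimpleGraph V → Prop}
    (h : ∀ H, p H → q H) : CoeffLE (edgeGenFun c W p) (edgeGenFun c W q) :=
  CoeffLE.sum_le_of_subset fun _ hH =>
    mem_graphsOn.2 ⟨(mem_graphsOn.1 hH).1, h _ (mem_graphsOn.1 hH).2⟩

theorem edgeGenFun_eq_zero {c : ℕ} {W : Finset V} {p : SimpleGraph V → Prop}
    (h : ∀ H : SimpleGraph V, H.support ⊆ W → ¬ p H) : edgeGenFun c W p = 0 :=
  sum_eq_zero fun _ hH => absurd (mem_graphsOn.1 hH).2 (h _ (mem_graphsOn.1 hH).1)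

open Classical in
theorem coeff_edgeGenFun (c : ℕ) (p : SimpleGraph V → Prop) (m : ℕ) :
    (edgeGenFun c univ p).coeff m = c ^ m * Nat.card {H // p H ∧ edgeCount H = m} := by
  have h : Nat.card {H // p H ∧ edgeCount H = m}
      = #((graphsOn univ p).filter fun H => edgeCount H = m) := by
    rw [Nat.card_eq_fintype_card, Fintype.card_subtype]
    congr 1
    ext H
    simp [mem_graphsOn]
  rw [h, edgeGenFun, finsetSum_coeff, card_filter, mul_sum]
  refine sum_congr rfl fun H _ => ?_
  rw [mul_pow, ← C_pow, coeff_C_mul, coeff_X_pow]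
  by_cases hm : edgeCount H = m
  · simp [hm]
  · simp [hm, Ne.symm hm]

theorem edgeGenFun_insert (c : ℕ) {v : V} {R U : Finset V} (hRU : Disjoint R U) (hvR : v ∉ R)
    (hvU : v ∉ U) (p : SimpleGraph V → Prop) :
    edgeGenFun c (insert v (R ∪ U)) p = ∑ D ∈ U.powerset, ∑ E ∈ R.powerset,
      (C c * X) ^ (#D + #E) * edgeGenFun c (R ∪ U) fun H => p (H.addStar v (D ∪ E)) := by
  classical
  simp only [edgeGenFun, mul_sum]
  rw [← sum_product', sum_sigma']
  symm
  have key : ∀ D ⊆ U, ∀ E ⊆ R, v ∉ D ∪ E := fun D hD E hE h => by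
    rcases mem_union.1 h with h | h
    · exact hvU (hD h)
    · exact hvR (hE h)
  have recover : ∀ H : SimpleGraph V, H.support ⊆ ↑(insert v (R ∪ U)) →
      (H.deleteIncidenceSet v).addStar v
        ((U.filter fun a => H.Adj v a) ∪ (R.filter fun a => H.Adj v a)) = H := by
    intro H hH
    ext a b
    rw [addStar_adj (key _ (filter_subset _ _) _ (filter_subset _ _)), deleteIncidenceSet_adj]
    have hmem : ∀ x, x ∈ (U.filter fun a => H.Adj v a) ∪ (R.filter fun a => H.Adj v a) ↔
        H.Adj v x := fun x => by
      simp only [mem_union, mem_filter, ← or_and_right, and_iff_right_iff_imp]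
      intro h
      have hx := (mem_insert.1 (hH ⟨v, h.symm⟩)).resolve_left h.ne'
      exact (mem_union.1 hx).symm
    rw [hmem, hmem]
    constructor
    · rintro (h | ⟨rfl, h⟩ | ⟨rfl, h⟩)
      · exact h.1
      · exact h
      · exact h.symm
    · intro h
      by_cases ha : a = v
      · exact Or.inr (Or.inl ⟨ha, ha ▸ h⟩)
      · by_cases hb : b = v
        · exact Or.inr (Or.inr ⟨hb, hb ▸ h.symm⟩)
        · exact Or.inl ⟨h, ha, hb⟩
  refine sum_bij' (fun x _ => x.2.addStar v (x.1.1 ∪ x.1.2))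
    (fun H _ => ⟨(U.filter fun a => H.Adj v a, R.filter fun a => H.Adj v a),
      H.deleteIncidenceSet v⟩) ?_ ?_ ?_ ?_ ?_
  · rintro ⟨⟨D, E⟩, H⟩ hx
    simp only [mem_sigma, mem_product, mem_powerset, mem_graphsOn] at hx ⊢
    obtain ⟨⟨hD, hE⟩, hH, hp⟩ := hx
    refine ⟨?_, hp⟩
    rintro a ⟨b, hab⟩
    replace hab := (addStar_adj (key D hD E hE)).1 hab
    rcases hab with h | ⟨rfl, -⟩ | ⟨-, h⟩
    · exact mem_coe.2 (mem_insert_of_mem (hH ⟨b, h⟩))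
    · simp
    · rcases mem_union.1 h with h | h
      · simp [hD h]
      · simp [hE h]
  · intro H hH
    simp only [mem_sigma, mem_product, mem_powerset, mem_graphsOn] at hH ⊢
    obtain ⟨hH, hp⟩ := hH
    refine ⟨⟨filter_subset _ _, filter_subset _ _⟩, ?_, ?_⟩
    · rintro a ⟨b, hab⟩
      obtain ⟨hab, hav, -⟩ := deleteIncidenceSet_adj.1 hab
      exact (mem_insert.1 (hH ⟨b, hab⟩)).resolve_left hav
    · rwa [recover H hH]
  · rintro ⟨⟨D, E⟩, H⟩ hx
    simp only [mem_sigma, mem_product, mem_powerset, mem_graphsOn] at hx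
    obtain ⟨⟨hD, hE⟩, hH, -⟩ := hx
    have hvH : ∀ a, ¬ H.Adj v a := fun a h => by
      have := hH ⟨a, h⟩
      simp [hvR, hvU] at this
    have hN := key D hD E hE
    have hadj : ∀ a, (H.addStar v (D ∪ E)).Adj v a ↔ a ∈ D ∪ E := fun a => by
      rw [addStar_adj hN]
      have := hvH a
      tauto
    have h₁ : (U.filter fun a => (H.addStar v (D ∪ E)).Adj v a) = D := by
      ext a
      simp only [mem_filter, hadj, mem_union]
      have := @hD a
      have := @hE a
      have hRUa : a ∈ R → a ∉ U := fun h => Finset.disjoint_left.1 hRU h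
      tauto
    have h₂ : (R.filter fun a => (H.addStar v (D ∪ E)).Adj v a) = E := by
      ext a
      simp only [mem_filter, hadj, mem_union]
      have := @hD a
      have := @hE a
      have hRUa : a ∈ R → a ∉ U := fun h => Finset.disjoint_left.1 hRU h
      tauto
    have h₃ : (H.addStar v (D ∪ E)).deleteIncidenceSet v = H := by
      ext a b
      rw [deleteIncidenceSet_adj, addStar_adj hN]
      constructor
      · rintro ⟨h | h | h, ha, hb⟩
        · exact h
        · exact absurd h.1 ha
        · exact absurd h.1 hb
      · refine fun h => ⟨Or.inl h, ?_, ?_⟩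
        · rintro rfl
          exact hvH b h
        · rintro rfl
          exact hvH a h.symm
    simp only [h₁, h₂, h₃]
  · intro H hH
    exact recover H (mem_graphsOn.1 hH).1
  · rintro ⟨⟨D, E⟩, H⟩ hx
    simp only [mem_sigma, mem_product, mem_powerset, mem_graphsOn] at hx ⊢
    obtain ⟨⟨hD, hE⟩, hH, -⟩ := hx
    have hvH : v ∉ H.support := fun h => by
      have := hH h
      simp [hvR, hvU] at this
    rw [edgeCount_addStar (key D hD E hE) hvH,
      card_union_of_disjoint (hRU.symm.mono hD hE), pow_add _ (#D + #E) (edgeCount H)]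

/-- Removing a root from the graphs that are counted without coloring condition. -/
theorem edgeGenFun_linked_insert {v : V} {R U : Finset V} (hRU : Disjoint R U) (hvR : v ∉ R)
    (hvU : v ∉ U) :
    edgeGenFun 1 (insert v (R ∪ U)) (Linked U) = (1 + X) ^ #R *
      ∑ D ∈ U.powerset, X ^ #D * edgeGenFun 1 (R ∪ U) (Linked (U \ D)) := by
  rw [edgeGenFun_insert 1 hRU hvR hvU, mul_sum]
  refine sum_congr rfl fun D hD => ?_
  have h : ∀ E ∈ R.powerset, (fun H : SimpleGraph V => Linked U (H.addStar v (D ∪ E)))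
      = Linked (U \ D) := fun E hE => by
    ext H
    exact linked_addStar (mem_powerset.1 hD) (hRU.mono_left (mem_powerset.1 hE))
      (fun h => hvR (mem_powerset.1 hE h)) hvU
  have hs := sum_powerset_pow_card 1 R
  simp only [C_1, one_mul] at hs
  rw [← hs, sum_mul]
  refine sum_congr rfl fun E hE => ?_
  rw [h E hE, C_1, one_mul, pow_add]
  ring

/-- Removing a root from the graphs that are counted with coloring condition. -/
theorem edgeGenFun_separable_insert_le (c : ℕ) {v : V} {P Q U : Finset V} (hPQ : Disjoint P Q)
    (hPU : Disjoint P U) (hQU : Disjoint Q U) (hv : v ∈ P) :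
    CoeffLE (edgeGenFun c (P ∪ Q ∪ U) fun H => Linked U H ∧ Separable P Q H)
      ((1 + C c * X) ^ #Q * ∑ D ∈ U.powerset, (C c * X) ^ #D *
        edgeGenFun c (P.erase v ∪ Q ∪ U)
          fun H => Linked (U \ D) H ∧ Separable (P.erase v) (Q ∪ D) H) := by
  have hvU : v ∉ U := Finset.disjoint_left.1 hPU hv
  have hvR : v ∉ P.erase v ∪ Q := by simp [Finset.disjoint_left.1 hPQ hv]
  have hRU : Disjoint (P.erase v ∪ Q) U :=
    disjoint_union_left.2 ⟨hPU.mono_left (erase_subset _ _), hQU⟩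
  have hW : P ∪ Q ∪ U = insert v (P.erase v ∪ Q ∪ U) := by
    rw [← insert_union, ← insert_union, insert_erase hv]
  rw [hW, edgeGenFun_insert c hRU hvR hvU, mul_sum]
  refine CoeffLE.sum fun D hD => ?_
  rw [mem_powerset] at hD
  rw [← sum_powerset_pow_card c Q, sum_mul]
  have hsub : Q.powerset ⊆ (P.erase v ∪ Q).powerset := powerset_mono.2 subset_union_right
  have hvN : ∀ E ⊆ P.erase v ∪ Q, v ∉ D ∪ E := fun E hE h => by
    rcases mem_union.1 h with h | h
    · exact hvU (hD h)
    · exact hvR (hE h)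
  rw [← sum_subset hsub]
  · refine CoeffLE.sum fun E hE => ?_
    have hE' := mem_powerset.1 (hsub hE)
    rw [pow_add, mul_comm ((C c * X : ℕ[X]) ^ #D), mul_assoc]
    refine CoeffLE.rfl.mul (CoeffLE.rfl.mul (edgeGenFun_mono fun H hH => ?_))
    exact ⟨(linked_addStar hD (hRU.mono_left hE') (fun h => hvR (hE' h)) hvU).1 hH.1,
      (hH.2.of_addStar hv (hvN E hE')).1⟩
  · intro E hE hEQ
    rw [mem_powerset] at hE hEQ
    rw [edgeGenFun_eq_zero, mul_zero]
    rintro H - ⟨-, hH⟩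
    have hdisj := (hH.of_addStar hv (hvN E hE)).2
    refine hEQ fun a ha => ?_
    rcases mem_union.1 (hE ha) with h | h
    · exact absurd (mem_of_mem_erase h) (Finset.disjoint_left.1 hdisj ha)
    · exact h

theorem edgeGenFun_separable_le_of_ind {P Q U : Finset V} (hPQ : Disjoint P Q)
    (hPU : Disjoint P U) (hQU : Disjoint Q U) (hcard : #Q ≤ #P) (hP : P.Nonempty)
    (ih : ∀ P' Q' U' : Finset V, Disjoint P' Q' → Disjoint P' U' → Disjoint Q' U' →
      #(P' ∪ Q' ∪ U') < #(P ∪ Q ∪ U) →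
      CoeffLE (edgeGenFun 2 (P' ∪ Q' ∪ U') fun H => Linked U' H ∧ Separable P' Q' H)
        (2 ^ #U' * (1 + X) ^ min #P' #Q' * edgeGenFun 1 (P' ∪ Q' ∪ U') (Linked U'))) :
    CoeffLE (edgeGenFun 2 (P ∪ Q ∪ U) fun H => Linked U H ∧ Separable P Q H)
      (2 ^ #U * (1 + X) ^ min #P #Q * edgeGenFun 1 (P ∪ Q ∪ U) (Linked U)) := by
  obtain ⟨v, hv⟩ := hP
  have hvU : v ∉ U := Finset.disjoint_left.1 hPU hv
  have hvR : v ∉ P.erase v ∪ Q := by simp [Finset.disjoint_left.1 hPQ hv]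
  have hPQ' : Disjoint (P.erase v) Q := hPQ.mono_left (erase_subset _ _)
  have hPU' : Disjoint (P.erase v) U := hPU.mono_left (erase_subset _ _)
  have hRU : Disjoint (P.erase v ∪ Q) U := disjoint_union_left.2 ⟨hPU', hQU⟩
  have hW : P ∪ Q ∪ U = insert v (P.erase v ∪ Q ∪ U) := by
    rw [← insert_union, ← insert_union, insert_erase hv]
  refine (edgeGenFun_separable_insert_le 2 hPQ hPU hQU hv).trans ?_
  rw [hW, edgeGenFun_linked_insert hRU hvR hvU, card_union_of_disjoint hPQ', min_eq_right hcard]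
  have hstep : ∀ D ∈ U.powerset, CoeffLE
      ((C 2 * X) ^ #D * edgeGenFun 2 (P.erase v ∪ Q ∪ U)
          fun H => Linked (U \ D) H ∧ Separable (P.erase v) (Q ∪ D) H)
      (2 ^ #U * (1 + X) ^ #(P.erase v) *
        (X ^ #D * edgeGenFun 1 (P.erase v ∪ Q ∪ U) (Linked (U \ D)))) := by
    intro D hD
    rw [mem_powerset] at hD
    have hWD : P.erase v ∪ (Q ∪ D) ∪ (U \ D) = P.erase v ∪ Q ∪ U := by
      rw [← union_assoc, union_assoc _ D, union_sdiff_of_subset hD]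
    have h := ih (P.erase v) (Q ∪ D) (U \ D)
      (disjoint_union_right.2 ⟨hPQ', hPU'.mono_right hD⟩) (hPU'.mono_right sdiff_subset)
      (disjoint_union_left.2 ⟨hQU.mono_right sdiff_subset, disjoint_sdiff⟩) (by
        rw [hWD, hW, card_insert_of_notMem (by simpa [hvU] using hvR)]
        exact Nat.lt_succ_self _)
    rw [hWD] at h
    refine (CoeffLE.rfl.mul h).trans ?_
    have h2 : (2 : ℕ[X]) ^ #U = 2 ^ #D * 2 ^ #(U \ D) := by
      rw [← pow_add, add_comm, card_sdiff_add_card_eq_card hD]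
    have hmin : CoeffLE ((1 + X) ^ min #(P.erase v) #(Q ∪ D)) ((1 + X) ^ #(P.erase v)) :=
      CoeffLE.one_add_X_pow_le (min_le_left _ _)
    refine ((CoeffLE.rfl (p := (C 2 * X) ^ #D * 2 ^ #(U \ D) *
      edgeGenFun 1 (P.erase v ∪ Q ∪ U) (Linked (U \ D)))).mul hmin |> fun h =>
        (CoeffLE.of_eq ?_).trans (h.trans (CoeffLE.of_eq ?_)))
    · ring
    · rw [h2, map_ofNat, mul_pow]
      ring
  refine ((CoeffLE.one_add_two_X_pow_le #Q).mul (CoeffLE.sum hstep)).trans (CoeffLE.of_eq ?_)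
  rw [← mul_sum]
  ring

theorem edgeGenFun_separable_le {P Q U : Finset V} (hPQ : Disjoint P Q) (hPU : Disjoint P U)
    (hQU : Disjoint Q U) :
    CoeffLE (edgeGenFun 2 (P ∪ Q ∪ U) fun H => Linked U H ∧ Separable P Q H)
      (2 ^ #U * (1 + X) ^ min #P #Q * edgeGenFun 1 (P ∪ Q ∪ U) (Linked U)) := by
  induction hn : #(P ∪ Q ∪ U) using Nat.strong_induction_on generalizing P Q U with
  | _ n ih =>
    subst hn
    have ih' : ∀ P' Q' U' : Finset V, Disjoint P' Q' → Disjoint P' U' → Disjoint Q' U' →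
        #(P' ∪ Q' ∪ U') < #(P ∪ Q ∪ U) →
        CoeffLE (edgeGenFun 2 (P' ∪ Q' ∪ U') fun H => Linked U' H ∧ Separable P' Q' H)
          (2 ^ #U' * (1 + X) ^ min #P' #Q' * edgeGenFun 1 (P' ∪ Q' ∪ U') (Linked U')) :=
      fun P' Q' U' h₁ h₂ h₃ h => ih _ h h₁ h₂ h₃ _root_.rfl
    rcases (P ∪ Q).eq_empty_or_nonempty with he | hne
    · rw [union_eq_empty] at he
      obtain ⟨rfl, rfl⟩ := he
      rcases U.eq_empty_or_nonempty with rfl | hU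
      · have hbot : ∀ p : SimpleGraph V → Prop, ∀ H ∈ graphsOn (∅ ∪ ∅ ∪ ∅) p, edgeCount H = 0 := by
          intro p H hH
          have h := (mem_graphsOn.1 hH).1
          have : H = ⊥ := by simpa using h
          simp [this, edgeCount]
        have heq : ∀ c (p : SimpleGraph V → Prop), edgeGenFun c (∅ ∪ ∅ ∪ ∅) p
            = edgeGenFun 1 (∅ ∪ ∅ ∪ ∅) p := fun c p =>
          sum_congr _root_.rfl fun H hH => by rw [hbot p H hH, pow_zero, pow_zero]
        rw [heq]
        simpa using edgeGenFun_mono (c := 1) (W := (∅ : Finset V)) fun H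
          (h : Linked ∅ H ∧ Separable ∅ ∅ H) => h.1
      · rw [edgeGenFun_eq_zero]
        · exact CoeffLE.zero_le
        · rintro H hH ⟨hL, -⟩
          obtain ⟨s, -, t, ht, hadj⟩ := hL U Subset.rfl hU
          exact ht (by simpa using hH ⟨s, hadj.symm⟩)
    · rcases le_total #Q #P with h | h
      · refine edgeGenFun_separable_le_of_ind hPQ hPU hQU h ?_ ih'
        rw [nonempty_iff_ne_empty]
        rintro rfl
        simp_all
      · rw [union_comm P Q, min_comm]
        refine (edgeGenFun_mono fun H hH => ⟨hH.1, hH.2.symm⟩).trans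
          (edgeGenFun_separable_le_of_ind hPQ.symm hQU hPU h ?_ ?_)
        · rw [nonempty_iff_ne_empty]
          rintro rfl
          simp_all
        · rwa [union_comm Q P]

theorem connected_iff_linked (H : SimpleGraph V) (r : V) :
    H.Connected ↔ Linked (univ.erase r) H := by
  classical
  constructor
  · rintro h S hS ⟨s, hs⟩
    obtain ⟨p⟩ := h.preconnected s r
    obtain ⟨d, -, h₁, h₂⟩ := p.exists_boundary_dart S hs fun hr => by simpa using hS hr
    exact ⟨d.fst, h₁, d.snd, h₂, d.adj⟩
  · intro h
    have hr : ∀ a, H.Reachable a r := by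
      by_contra! hne
      obtain ⟨a, ha⟩ := hne
      obtain ⟨s, hs, t, ht, hadj⟩ := h (univ.filter fun a => ¬ H.Reachable a r)
        (fun x hx => by
          rw [mem_erase]
          refine ⟨?_, mem_univ _⟩
          rintro rfl
          simp at hx)
        ⟨a, by simpa using ha⟩
      simp only [mem_filter, mem_univ, true_and, not_not] at hs ht
      exact hs (hadj.reachable.trans ht)
    exact (connected_iff _).2 ⟨fun a b => (hr a).trans (hr b).symm, ⟨r⟩⟩

end SimpleGraph

open SimpleGraph in
/-- for `n ≥ 1` and any `m`, `2^{m+1} C^e(n,m) ≤ 2^n C(n,m)`, i.e. the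
number of connected bipartite (no odd cycle) graphs on `{1,…,n}` with `m` edges is at most
`(1/2)^{m+1-n}` times the number of all connected graphs on `{1,…,n}` with `m` edges. -/
theorem CconnE_le (n m : ℕ) (hn : 1 ≤ n) :
    2 ^ (m + 1) * CconnE n m ≤ 2 ^ n * Cconn n m := by
  obtain ⟨k, rfl⟩ := Nat.exists_eq_add_of_le' hn
  let r : Fin (k + 1) := 0
  have hW : ({r} : Finset (Fin (k + 1))) ∪ ∅ ∪ univ.erase r = univ := by
    ext a
    simp
  have h := edgeGenFun_separable_le (P := {r}) (Q := ∅) (U := univ.erase r) (by simp) (by simp)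
    (by simp) m
  rw [hW] at h
  have hU : #((univ : Finset (Fin (k + 1))).erase r) = k := by simp
  rw [hU, card_empty, Nat.min_zero, pow_zero, mul_one, coeff_edgeGenFun, ← map_ofNat C 2, ← C_pow,
    coeff_C_mul, coeff_edgeGenFun, one_pow, one_mul] at h
  have hC : Nat.card {H : SimpleGraph (Fin (k + 1)) // Linked (univ.erase r) H ∧ edgeCount H = m}
      = Cconn (k + 1) m := by
    simp only [Cconn, connected_iff_linked _ r]
  have hE : CconnE (k + 1) m ≤ Nat.card {H : SimpleGraph (Fin (k + 1)) //
      (Linked (univ.erase r) H ∧ Separable {r} ∅ H) ∧ edgeCount H = m} :=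
    Nat.card_mono (Set.toFinite _) fun H hH =>
      ⟨⟨(connected_iff_linked H r).1 hH.1, separable_of_hasNoOddCycle hH.2.2 r⟩, hH.2.1⟩
  rw [hC] at h
  calc 2 ^ (m + 1) * CconnE (k + 1) m = 2 * (2 ^ m * CconnE (k + 1) m) := by ring
    _ ≤ 2 * (2 ^ k * Cconn (k + 1) m) :=
      Nat.mul_le_mul_left 2 ((Nat.mul_le_mul_left _ hE).trans h)
    _ = 2 ^ (k + 1) * Cconn (k + 1) m := by ring
end

section
/- For all integers n ≥ 3 and m with n−1 ≤ m ≤ N := n(n−1)/2, one has 2m·C^e(n,m) ≤ (N−m+1)·C^e(n,m−1) + Σ binom(n,n₁)·n₁·n₂·C^e(n₁,m₁)·C^e(n₂,m₂), where the sum is over all ordered quadruples (n₁,n₂,m₁,m₂) of nonnegative integers with n₁ + n₂ = n, n₁,n₂ ≥ 1, and m₁ + m₂ = m − 1. -/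
open Finset

/-- A connected graph with `m` edges and no odd cycle. -/
structure IsConnBip {V : Type*} (G : SimpleGraph V) (m : ℕ) : Prop where
  connected : G.Connected
  edgeCount_eq : edgeCount G = m
  noOddCycle : HasNoOddCycle G

theorem HasNoOddCycle.of_hom {V W : Type*} {G : SimpleGraph V} {H : SimpleGraph W}
    (h : HasNoOddCycle H) (f : G →g H) (hf : Function.Injective f) : HasNoOddCycle G := by
  intro v w hw
  simpa using h _ (w.map f) (hw.map hf)

theorem HasNoOddCycle.mono {V : Type*} {G H : SimpleGraph V}
    (h : HasNoOddCycle H) (hle : G ≤ H) : HasNoOddCycle G :=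
  h.of_hom (SimpleGraph.Hom.ofLE hle) fun _ _ h ↦ h

theorem IsConnBip.of_iso {V W : Type*} {G : SimpleGraph V} {H : SimpleGraph W} {m : ℕ}
    (h : IsConnBip G m) (e : G ≃g H) : IsConnBip H m where
  connected := e.connected_iff.1 h.connected
  edgeCount_eq := by
    rw [← h.edgeCount_eq]
    exact (Nat.card_congr e.mapEdgeSet).symm
  noOddCycle := h.noOddCycle.of_hom e.symm.toHom e.symm.injective

theorem isConnBip_simpleGraph_iff {V W : Type*} (e : V ≃ W) (G : SimpleGraph V) (m : ℕ) :
    IsConnBip (e.simpleGraph G) m ↔ IsConnBip G m :=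
  ⟨fun h ↦ h.of_iso (SimpleGraph.Iso.comap e.symm G), fun h ↦
    h.of_iso (SimpleGraph.Iso.comap e.symm G).symm⟩

open Classical in
/-- The finset of connected graphs on `V` with `m` edges and no odd cycle. -/
noncomputable def connBip (V : Type*) [Fintype V] (m : ℕ) : Finset (SimpleGraph V) :=
  {G | IsConnBip G m}

theorem mem_connBip {V : Type*} [Fintype V] {m : ℕ} {G : SimpleGraph V} :
    G ∈ connBip V m ↔ IsConnBip G m := by
  simp [connBip]

theorem card_connBip (V : Type*) [Fintype V] (m : ℕ) :
    #(connBip V m) = CconnE (Fintype.card V) m := by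
  have h1 : #(connBip V m) = Nat.card {G : SimpleGraph V // IsConnBip G m} :=
    (Nat.subtype_card _ fun G ↦ mem_connBip).symm
  rw [h1]
  refine Nat.card_congr ((Fintype.equivFin V).simpleGraph.subtypeEquiv fun G ↦ ?_)
  rw [← isConnBip_simpleGraph_iff (Fintype.equivFin V)]
  exact ⟨fun ⟨h1, h2, h3⟩ ↦ ⟨h1, h2, h3⟩, fun ⟨h1, h2, h3⟩ ↦ ⟨h1, h2, h3⟩⟩

open Classical in
theorem card_adj_pairs {V : Type*} [Fintype V] (G : SimpleGraph V) :
    #{p : V × V | G.Adj p.1 p.2} = 2 * edgeCount G := by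
  have h : edgeCount G = #G.edgeFinset := by
    rw [edgeCount, ← SimpleGraph.coe_edgeFinset, Set.ncard_coe_finset]
  rw [h, ← G.dart_card_eq_twice_card_edges, ← card_univ]
  refine (card_nbij (fun d ↦ d.toProd) ?_ ?_ ?_).symm
  · intro d _
    simp
  · intro d _ d' _ h
    exact SimpleGraph.Dart.ext _ _ h
  · intro p hp
    exact ⟨⟨p, by simpa using hp⟩, by simp⟩

theorem exists_coloring_of_isTree {V : Type*} {T : SimpleGraph V} (hT : T.IsTree) :
    Nonempty (T.Coloring Bool) := by
  obtain ⟨r⟩ := hT.1.nonempty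
  refine ⟨SimpleGraph.Coloring.mk (fun x ↦ decide (Even (T.dist r x))) fun {x y} hxy heq ↦ ?_⟩
  have hne := hT.dist_ne_of_adj r hxy
  have hd := hxy.diff_dist_adj (u := r)
  simp only [decide_eq_decide] at heq
  grind

theorem HasNoOddCycle.coloring_ne {V : Type*} {T G : SimpleGraph V} (hG : HasNoOddCycle G)
    (hT : T.Connected) (hle : T ≤ G) (c : T.Coloring Bool) {u v : V} (huv : G.Adj u v) :
    c u ≠ c v := by
  by_cases hadj : T.Adj u v
  · exact c.valid hadj
  obtain ⟨p, hp⟩ := hT.exists_isPath v u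
  have hq : (p.mapLe hle).IsPath := hp.mapLe hle
  have hcyc : (SimpleGraph.Walk.cons huv (p.mapLe hle)).IsCycle := by
    rw [SimpleGraph.Walk.cons_isCycle_iff]
    refine ⟨hq, fun hmem ↦ hadj ?_⟩
    rw [SimpleGraph.Walk.edges_mapLe_eq_edges] at hmem
    exact p.adj_of_mem_edges hmem
  have heven := hG _ _ hcyc
  have := c.even_length_iff_congr p
  simp [Nat.even_add_one] at heven
  grind

open Classical in
theorem two_mul_card_bichromatic_pairs_le {V : Type*} [Fintype V] (c : V → Bool) :
    2 * #{p : V × V | c p.1 ≠ c p.2} ≤ Fintype.card V ^ 2 := by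
  have h : ({p : V × V | c p.1 ≠ c p.2} : Finset (V × V)) =
      ({x | c x} : Finset V) ×ˢ ({x | ¬ c x} : Finset V) ∪
        ({x | ¬ c x} : Finset V) ×ˢ ({x | c x} : Finset V) := by
    ext p
    simp only [mem_filter, mem_univ, true_and, mem_union, mem_product]
    cases c p.1 <;> cases c p.2 <;> simp
  have hn : #({x | c x} : Finset V) + #({x | ¬ c x} : Finset V) = Fintype.card V := by
    rw [card_filter_add_card_filter_not, card_univ]
  have hu := card_union_le (({x | c x} : Finset V) ×ˢ ({x | ¬ c x} : Finset V))
        (({x | ¬ c x} : Finset V) ×ˢ ({x | c x} : Finset V))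
  rw [← h, card_product, card_product] at hu
  rw [← hn]
  set a := #({x | c x} : Finset V)
  set b := #({x | ¬ c x} : Finset V)
  zify at hu ⊢
  nlinarith [sq_nonneg ((a : ℤ) - b)]

open Classical in
theorem two_mul_card_augmenting_pairs_add_le {V : Type*} [Fintype V] {H : SimpleGraph V} {m : ℕ}
    (hH : IsConnBip H m) :
    2 * (#{p : V × V | ¬ H.Adj p.1 p.2 ∧ ∃ G, H ≤ G ∧ HasNoOddCycle G ∧ G.Adj p.1 p.2} + 2 * m) ≤
      Fintype.card V ^ 2 := by
  obtain ⟨T, hTH, hT⟩ := hH.connected.exists_isTree_le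
  obtain ⟨c⟩ := exists_coloring_of_isTree hT
  refine le_trans ?_ (two_mul_card_bichromatic_pairs_le c)
  rw [← hH.edgeCount_eq, ← card_adj_pairs, ← card_union_of_disjoint]
  · gcongr
    intro p hp
    simp only [mem_union, mem_filter, mem_univ, true_and] at hp ⊢
    obtain ⟨-, G, hHG, hG, hadj⟩ | hadj := hp
    · exact hG.coloring_ne hT.1 (hTH.trans hHG) c hadj
    · exact hH.noOddCycle.coloring_ne hT.1 hTH c hadj
  · rw [disjoint_filter]
    intro p _ hp
    exact hp.1

theorem IsConnBip.card_le {V : Type*} [Fintype V] {H : SimpleGraph V} {m : ℕ}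
    (hH : IsConnBip H m) : Fintype.card V ≤ m + 1 := by
  have := hH.connected.card_vert_le_card_edgeSet_add_one
  rwa [Nat.card_eq_fintype_card, Nat.card_coe_set_eq, ← edgeCount, hH.edgeCount_eq] at this

open Classical in
theorem card_augmenting_pairs_le {V : Type*} [Fintype V] {H : SimpleGraph V} {n m : ℕ}
    (hV : Fintype.card V = n) (hn : 2 ≤ n) (hm : m ≤ n * (n - 1) / 2) (hH : IsConnBip H m) :
    #{p : V × V | ¬ H.Adj p.1 p.2 ∧ ∃ G, H ≤ G ∧ HasNoOddCycle G ∧ G.Adj p.1 p.2} ≤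
      n * (n - 1) / 2 - m := by
  have h1 := two_mul_card_augmenting_pairs_add_le hH
  have h2 := hH.card_le
  rw [hV] at h1 h2
  obtain ⟨k, rfl⟩ : ∃ k, n = k + 1 := ⟨n - 1, by lia⟩
  simp only [Nat.add_sub_cancel] at hm ⊢
  have h3 : 2 * ((k + 1) * k / 2) = (k + 1) * k :=
    Nat.mul_div_cancel' (by simpa [mul_comm] using (Nat.even_mul_succ_self k).two_dvd)
  zify [hm] at *
  nlinarith

theorem edgeCount_deleteEdges {V : Type*} [Fintype V] {G : SimpleGraph V} {u v : V}
    (h : G.Adj u v) : edgeCount (G.deleteEdges {s(u, v)}) = edgeCount G - 1 := by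
  rw [edgeCount, SimpleGraph.edgeSet_deleteEdges, Set.ncard_sdiff_singleton_of_mem (by simpa),
    edgeCount]

theorem eq_of_deleteEdges_eq {V : Type*} {G H : SimpleGraph V} {u v : V}
    (hG : G.Adj u v) (hH : H.Adj u v)
    (h : G.deleteEdges {s(u, v)} = H.deleteEdges {s(u, v)}) : G = H := by
  ext x y
  have := congrArg (fun K ↦ K.Adj x y) h
  simp only [SimpleGraph.deleteEdges_adj, Set.mem_singleton_iff] at this
  by_cases hxy : s(x, y) = s(u, v)
  · rw [← SimpleGraph.mem_edgeSet, ← SimpleGraph.mem_edgeSet, hxy]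
    simp [hG, hH]
  · simpa [hxy] using this

theorem reachable_deleteEdges_or {V : Type*} {G : SimpleGraph V} (hG : G.Connected) (u v w : V) :
    (G.deleteEdges {s(u, v)}).Reachable u w ∨ (G.deleteEdges {s(u, v)}).Reachable v w := by
  obtain ⟨p⟩ := hG u w
  suffices ∀ x y, G.Walk x y → ((G.deleteEdges {s(u, v)}).Reachable u x ∨
      (G.deleteEdges {s(u, v)}).Reachable v x) → ((G.deleteEdges {s(u, v)}).Reachable u y ∨
      (G.deleteEdges {s(u, v)}).Reachable v y) from this u w p (.inl .rfl)
  intro x y q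
  induction q with
  | nil => exact id
  | @cons a b c hab q ih =>
    refine fun h ↦ ih ?_
    by_cases he : s(a, b) = s(u, v)
    · obtain ⟨-, rfl⟩ | ⟨-, rfl⟩ := Sym2.eq_iff.1 he
      · exact .inr .rfl
      · exact .inl .rfl
    · have hadj : (G.deleteEdges {s(u, v)}).Reachable a b :=
        SimpleGraph.Adj.reachable (by simpa [he] using hab)
      exact h.imp (·.trans hadj) (·.trans hadj)

theorem connected_comap_of_reachable {V : Type*} {H : SimpleGraph V} {P : V → Prop} {u : V}
    (hP : ∀ w, P w ↔ H.Reachable u w) :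
    (H.comap (Subtype.val : {x // P x} → V)).Connected := by
  obtain rfl : P = fun w ↦ w ∈ (H.connectedComponentMk u).supp := by
    funext w
    rw [hP, SimpleGraph.ConnectedComponent.mem_supp_iff, SimpleGraph.ConnectedComponent.eq,
      SimpleGraph.reachable_comm]
  exact (H.connectedComponentMk u).connected_toSimpleGraph

open Classical in
theorem two_mul_edgeCount_comap {V : Type*} [Fintype V] {H : SimpleGraph V} {P : V → Prop}
    (hP : ∀ x y, H.Adj x y → P x → P y) :
    2 * edgeCount (H.comap (Subtype.val : {x // P x} → V)) =
      #{p : V × V | H.Adj p.1 p.2 ∧ P p.1} := by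
  rw [← card_adj_pairs]
  refine card_nbij (fun p ↦ (p.1.1, p.2.1)) ?_ ?_ ?_
  · rintro ⟨⟨x, hx⟩, ⟨y, hy⟩⟩ h
    simpa [hx] using h
  · rintro ⟨⟨x, hx⟩, ⟨y, hy⟩⟩ _ ⟨⟨x', hx'⟩, ⟨y', hy'⟩⟩ _ h
    simpa using h
  · rintro ⟨x, y⟩ h
    simp only [coe_filter, mem_univ, true_and, Set.mem_ofPred_eq] at h
    exact ⟨(⟨x, h.2⟩, ⟨y, hP _ _ h.1 h.2⟩), by simpa using h.1, rfl⟩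

/-- A graph with `m` edges and no odd cycle whose components are exactly `S` and `Sᶜ`. -/
structure IsSplit {V : Type*} [Fintype V] [DecidableEq V] (S : Finset V) (H : SimpleGraph V)
    (m : ℕ) : Prop where
  mem_iff : ∀ x y, H.Adj x y → (x ∈ S ↔ y ∈ S)
  connected : (H.comap (Subtype.val : {x // x ∈ S} → V)).Connected
  connected_compl : (H.comap (Subtype.val : {x // x ∈ Sᶜ} → V)).Connected
  edgeCount_eq : edgeCount H = m
  noOddCycle : HasNoOddCycle H

theorem HasNoOddCycle.comap_val {V : Type*} {H : SimpleGraph V} (h : HasNoOddCycle H)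
    (P : V → Prop) : HasNoOddCycle (H.comap (Subtype.val : {x // P x} → V)) :=
  h.of_hom ⟨Subtype.val, id⟩ Subtype.val_injective

theorem IsSplit.edgeCount_add {V : Type*} [Fintype V] [DecidableEq V] {S : Finset V}
    {H : SimpleGraph V} {m : ℕ} (h : IsSplit S H m) :
    edgeCount (H.comap (Subtype.val : {x // x ∈ S} → V)) +
      edgeCount (H.comap (Subtype.val : {x // x ∈ Sᶜ} → V)) = m := by
  classical
  have h1 := two_mul_edgeCount_comap (H := H) (P := (· ∈ S)) fun x y hxy ↦ (h.mem_iff x y hxy).1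
  have h2 := two_mul_edgeCount_comap (H := H) (P := (· ∈ Sᶜ)) fun x y hxy ↦ by
    simpa using mt (h.mem_iff x y hxy).2
  have h3 := card_adj_pairs H
  rw [← card_filter_add_card_filter_not (fun p ↦ p.1 ∈ S), filter_filter, filter_filter,
    h.edgeCount_eq] at h3
  refine Nat.eq_of_mul_eq_mul_left two_pos ?_
  rw [mul_add, h1, h2, ← h3]
  simp only [mem_compl]
  congr!

theorem eq_of_comap_eq {V : Type*} [Fintype V] [DecidableEq V] {S : Finset V}
    {H K : SimpleGraph V} (hH : ∀ x y, H.Adj x y → (x ∈ S ↔ y ∈ S))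
    (hK : ∀ x y, K.Adj x y → (x ∈ S ↔ y ∈ S))
    (h1 : H.comap (Subtype.val : {x // x ∈ S} → V) = K.comap Subtype.val)
    (h2 : H.comap (Subtype.val : {x // x ∈ Sᶜ} → V) = K.comap Subtype.val) : H = K := by
  ext x y
  by_cases hxy : x ∈ S ↔ y ∈ S
  · by_cases hx : x ∈ S
    · simpa using congrArg (fun L ↦ L.Adj ⟨x, hx⟩ ⟨y, hxy.1 hx⟩) h1
    · simpa using congrArg
        (fun L ↦ L.Adj ⟨x, mem_compl.2 hx⟩ ⟨y, mem_compl.2 (mt hxy.2 hx)⟩) h2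
  · exact iff_of_false (mt (hH x y) hxy) (mt (hK x y) hxy)

open Classical in
theorem card_isSplit_le {V : Type*} [Fintype V] (S : Finset V) (m : ℕ) :
    #{H : SimpleGraph V | IsSplit S H m} ≤
      ∑ k ∈ range (m + 1), CconnE #S k * CconnE (Fintype.card V - #S) (m - k) := by
  calc
    _ ≤ #((range (m + 1)).sigma fun k ↦
        connBip {x // x ∈ S} k ×ˢ connBip {x // x ∈ Sᶜ} (m - k)) := by
      refine card_le_card_of_injOn (fun H ↦ ⟨edgeCount (H.comap (Subtype.val : {x // x ∈ S} → V)),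
        H.comap Subtype.val, H.comap Subtype.val⟩) ?_ ?_
      · intro H hH
        have hH : IsSplit S H m := by simpa using hH
        have hadd := hH.edgeCount_add
        simp only [coe_sigma, Set.mem_sigma_iff, mem_coe, mem_range, mem_product, mem_connBip]
        exact ⟨by lia, ⟨hH.connected, rfl, hH.noOddCycle.comap_val _⟩,
          ⟨hH.connected_compl, by lia, hH.noOddCycle.comap_val _⟩⟩
      · intro H hH K hK hHK
        have hH : IsSplit S H m := by simpa using hH
        have hK : IsSplit S K m := by simpa using hK
        simp only [Sigma.mk.injEq, heq_eq_eq, Prod.mk.injEq] at hHK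
        exact eq_of_comap_eq hH.mem_iff hK.mem_iff hHK.2.1 hHK.2.2
    _ = _ := by
      simp [card_sigma, card_connBip]

open Classical in
theorem isSplit_of_not_reachable {V : Type*} [Fintype V] {G : SimpleGraph V} {m : ℕ} {u v : V}
    (hG : IsConnBip G m) (huv : G.Adj u v)
    (h : ¬ (G.deleteEdges {s(u, v)}).Reachable u v) :
    IsSplit {w | (G.deleteEdges {s(u, v)}).Reachable u w} (G.deleteEdges {s(u, v)}) (m - 1) where
  mem_iff x y hxy := by
    simp only [mem_filter, mem_univ, true_and]
    exact ⟨(·.trans hxy.reachable), (·.trans hxy.symm.reachable)⟩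
  connected := connected_comap_of_reachable (u := u) (by simp)
  connected_compl := by
    refine connected_comap_of_reachable (u := v) fun w ↦ ?_
    simp only [mem_compl, mem_filter, mem_univ, true_and]
    exact ⟨(reachable_deleteEdges_or hG.connected u v w).resolve_left,
      fun hv hu ↦ h (hu.trans hv.symm)⟩
  edgeCount_eq := by rw [edgeCount_deleteEdges huv, hG.edgeCount_eq]
  noOddCycle := hG.noOddCycle.mono (SimpleGraph.deleteEdges_le _)

open Classical in
/-- Pairs of a graph in `connBip V m` and an ordered pair of adjacent vertices. -/
noncomputable def connBipDarts (V : Type*) [Fintype V] (m : ℕ) :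
    Finset (Σ _ : SimpleGraph V, V × V) :=
  (connBip V m).sigma fun G ↦ {p | G.Adj p.1 p.2}

theorem mem_connBipDarts {V : Type*} [Fintype V] {m : ℕ} {x : Σ _ : SimpleGraph V, V × V} :
    x ∈ connBipDarts V m ↔ IsConnBip x.1 m ∧ x.1.Adj x.2.1 x.2.2 := by
  simp [connBipDarts, mem_connBip]

theorem card_connBipDarts (V : Type*) [Fintype V] (m : ℕ) :
    #(connBipDarts V m) = 2 * m * CconnE (Fintype.card V) m := by
  classical
  rw [connBipDarts, card_sigma, ← card_connBip, mul_comm, ← smul_eq_mul]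
  refine sum_eq_card_nsmul fun G hG ↦ ?_
  rw [← (mem_connBip.1 hG).edgeCount_eq, ← card_adj_pairs]

open Classical in
theorem card_nonbridge_darts_le {V : Type*} [Fintype V] {n m : ℕ}
    (hV : Fintype.card V = n) (hn : 2 ≤ n) (hm : m - 1 ≤ n * (n - 1) / 2) :
    #{x ∈ connBipDarts V m | (x.1.deleteEdges {s(x.2.1, x.2.2)}).Reachable x.2.1 x.2.2} ≤
      (n * (n - 1) / 2 - (m - 1)) * CconnE n (m - 1) := by
  calc
    _ ≤ #((connBip V (m - 1)).sigma fun H ↦ {p : V × V | ¬ H.Adj p.1 p.2 ∧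
          ∃ G, H ≤ G ∧ HasNoOddCycle G ∧ G.Adj p.1 p.2}) := by
      refine card_le_card_of_injOn
        (fun x ↦ ⟨x.1.deleteEdges {s(x.2.1, x.2.2)}, x.2⟩) ?_ ?_
      · rintro ⟨G, u, v⟩ hx
        simp only [coe_filter, mem_connBipDarts, Set.mem_ofPred_eq] at hx
        obtain ⟨⟨hG, huv⟩, hr⟩ := hx
        simp only [coe_sigma, Set.mem_sigma_iff, mem_coe, mem_connBip, mem_filter, mem_univ,
          true_and]
        refine ⟨⟨hG.connected.connected_delete_edge_of_not_isBridge ?_, ?_,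
          hG.noOddCycle.mono (SimpleGraph.deleteEdges_le _)⟩, by simp, G,
          SimpleGraph.deleteEdges_le _, hG.noOddCycle, huv⟩
        · simpa [SimpleGraph.isBridge_iff] using hr
        · rw [edgeCount_deleteEdges huv, hG.edgeCount_eq]
      · rintro ⟨G, p⟩ hG ⟨K, q⟩ hK h
        simp only [coe_filter, mem_connBipDarts, Set.mem_ofPred_eq] at hG hK
        simp only [Sigma.mk.injEq, heq_eq_eq] at h
        obtain ⟨h, rfl⟩ := h
        rw [eq_of_deleteEdges_eq hG.1.2 hK.1.2 h]
    _ ≤ _ := by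
      rw [card_sigma, ← hV, ← card_connBip, mul_comm, ← smul_eq_mul]
      refine sum_le_card_nsmul _ _ _ fun H hH ↦ ?_
      exact card_augmenting_pairs_le rfl (hV ▸ hn) (hV ▸ hm) (mem_connBip.1 hH)

open Classical in
theorem card_bridge_darts_le (V : Type*) [Fintype V] (m : ℕ) :
    #{x ∈ connBipDarts V m | ¬ (x.1.deleteEdges {s(x.2.1, x.2.2)}).Reachable x.2.1 x.2.2} ≤
      ∑ S : Finset V, #{H : SimpleGraph V | IsSplit S H (m - 1)} *
        (#S * (Fintype.card V - #S)) := by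
  calc
    _ ≤ #((univ : Finset (Finset V)).sigma fun S ↦
        ({H : SimpleGraph V | IsSplit S H (m - 1)} : Finset _) ×ˢ S ×ˢ Sᶜ) := by
      refine card_le_card_of_injOn
        (fun x ↦ ⟨({w | (x.1.deleteEdges {s(x.2.1, x.2.2)}).Reachable x.2.1 w} : Finset V),
          x.1.deleteEdges {s(x.2.1, x.2.2)}, x.2⟩) ?_ ?_
      · rintro ⟨G, u, v⟩ hx
        simp only [coe_filter, mem_connBipDarts, Set.mem_ofPred_eq] at hx
        obtain ⟨⟨hG, huv⟩, hr⟩ := hx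
        simpa [hr] using isSplit_of_not_reachable hG huv hr
      · rintro ⟨G, p⟩ hG ⟨K, q⟩ hK h
        simp only [coe_filter, mem_connBipDarts, Set.mem_ofPred_eq] at hG hK
        simp only [Sigma.mk.injEq, heq_eq_eq, Prod.mk.injEq] at h
        obtain ⟨-, h, rfl⟩ := h
        rw [eq_of_deleteEdges_eq hG.1.2 hK.1.2 h]
    _ = _ := by
      simp [card_sigma, card_compl]

open Classical in
theorem sum_card_isSplit_le (V : Type*) [Fintype V] {m : ℕ} (hm : 1 ≤ m) :
    ∑ S : Finset V, #{H : SimpleGraph V | IsSplit S H (m - 1)} * (#S * (Fintype.card V - #S)) ≤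
      ∑ a ∈ Ioo 0 (Fintype.card V), ∑ k ∈ range m, (Fintype.card V).choose a * a *
        (Fintype.card V - a) * CconnE a k * CconnE (Fintype.card V - a) (m - 1 - k) := by
  let f (a : ℕ) : ℕ := (∑ k ∈ range m, CconnE a k * CconnE (Fintype.card V - a) (m - 1 - k)) * (a * (Fintype.card V - a))
  calc
    _ ≤ ∑ S : Finset V, f #S := by
      refine sum_le_sum fun S _ ↦ ?_
      have := card_isSplit_le S (m - 1)
      rw [Nat.sub_add_cancel hm] at this
      exact Nat.mul_le_mul_right _ this
    _ = ∑ a ∈ range (Fintype.card V + 1), (Fintype.card V).choose a * f a := by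
      rw [← powerset_univ, sum_powerset_apply_card, card_univ]
      simp
    _ = ∑ a ∈ Ioo 0 (Fintype.card V), (Fintype.card V).choose a * f a := by
      refine (sum_subset (fun a ha ↦ ?_) fun a ha ha' ↦ ?_).symm
      · simp only [mem_Ioo, mem_range] at ha ⊢
        lia
      · simp only [mem_Ioo, mem_range] at ha ha'
        obtain rfl | rfl : a = 0 ∨ a = Fintype.card V := by lia
        · simp [f]
        · simp [f]
    _ ≤ _ := by
      refine le_of_eq (sum_congr rfl fun a _ ↦ ?_)
      simp only [f, sum_mul, mul_sum]
      exact sum_congr rfl fun k _ ↦ by ring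

theorem card_connBipDarts_le (V : Type*) [Fintype V] {n m : ℕ} (hV : Fintype.card V = n)
    (hn : 2 ≤ n) (hm : 1 ≤ m) (hm' : m - 1 ≤ n * (n - 1) / 2) :
    #(connBipDarts V m) ≤ (n * (n - 1) / 2 - (m - 1)) * CconnE n (m - 1) +
      ∑ a ∈ Ioo 0 n, ∑ k ∈ range m,
        n.choose a * a * (n - a) * CconnE a k * CconnE (n - a) (m - 1 - k) := by
  classical
  rw [← card_filter_add_card_filter_not
    (fun x ↦ (x.1.deleteEdges {s(x.2.1, x.2.2)}).Reachable x.2.1 x.2.2)]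
  refine add_le_add ((card_nonbridge_darts_le hV hn hm').trans' (by congr!)) ?_
  have h := (card_bridge_darts_le V m).trans (sum_card_isSplit_le V hm)
  rw [hV] at h
  exact h.trans' (by congr!)

/-- for `n ≥ 3` and `n-1 ≤ m ≤ N = n(n-1)/2`,
`2m C^e(n,m) ≤ (N-m+1) C^e(n,m-1) + Σ binom(n,n₁) n₁ n₂ C^e(n₁,m₁) C^e(n₂,m₂)`,
the sum being over `n₁+n₂ = n`, `n₁,n₂ ≥ 1`, `m₁+m₂ = m-1`. -/
theorem CconnE_recurrence_ineq (n m : ℕ) (hn : 3 ≤ n) (hm1 : n - 1 ≤ m)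
    (hm2 : m ≤ n * (n - 1) / 2) :
    2 * m * CconnE n m ≤
      (n * (n - 1) / 2 - m + 1) * CconnE n (m - 1) +
        ∑ n₁ ∈ Finset.Ioo 0 n, ∑ m₁ ∈ Finset.range m,
          n.choose n₁ * n₁ * (n - n₁) * CconnE n₁ m₁ * CconnE (n - n₁) (m - 1 - m₁) := by
  have h := card_connBipDarts_le (Fin n) (m := m) (Fintype.card_fin n) (by lia) (by lia) (by lia)
  rwa [card_connBipDarts, Fintype.card_fin,
    show n * (n - 1) / 2 - (m - 1) = n * (n - 1) / 2 - m + 1 by lia] at h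
end
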